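/- arXiv:2502.17218 — 3 statements merged into one kernel-verified Lean document; each statement's English description precedes it below -/
import Mathlib

section
/- Let v, v′ be two distinct integers, let p ≥ max(5, |v − v′| + 1) be a prime number, and let λ ∈ 𝔽_p. Let S = {T(λ−v), T(λ−v′)} ⊆ PSL₂(p). Then the subgroup of PSL₂(p) generated by S²S^{−2} = { g₁g₂g₃⁻¹g₄⁻¹ : g₁, g₂, g₃, g₄ ∈ S } is all of PSL₂(p), and likewise the subgroup generated by S^{−2}S² = { g₁⁻¹g₂⁻¹g₃g₄ : g₁, g₂, g₃, g₄ ∈ S } is all of PSL₂(p). -/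
open Matrix
open scoped MatrixGroups

noncomputable section

/-- The transfer matrix `T(μ) = [[μ, -1], [1, 0]]` as an element of `SL(2, ZMod p)`. -/
def Tsl {p : ℕ} (μ : ZMod p) : SL(2, ZMod p) :=
  ⟨!![μ, -1; 1, 0], by simp [Matrix.det_fin_two_of]⟩

/-- The image of `T(μ)` in `PSL(2, ZMod p)`. -/
def Tbar {p : ℕ} (μ : ZMod p) : PSL(2, ZMod p) :=
  QuotientGroup.mk (Tsl μ)

def Usl {p : ℕ} (x : ZMod p) : SL(2, ZMod p) :=
  ⟨!![1, x; 0, 1], by simp [Matrix.det_fin_two_of]⟩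

def Lsl {p : ℕ} (x : ZMod p) : SL(2, ZMod p) :=
  ⟨!![1, 0; x, 1], by simp [Matrix.det_fin_two_of]⟩

lemma Usl_coe {p : ℕ} (x : ZMod p) : (Usl x : Matrix (Fin 2) (Fin 2) (ZMod p)) = !![1, x; 0, 1] := rfl

lemma Lsl_coe {p : ℕ} (x : ZMod p) : (Lsl x : Matrix (Fin 2) (Fin 2) (ZMod p)) = !![1, 0; x, 1] := rfl

lemma Tsl_coe {p : ℕ} (x : ZMod p) : (Tsl x : Matrix (Fin 2) (Fin 2) (ZMod p)) = !![x, -1; 1, 0] := rfl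

lemma Usl_mul {p : ℕ} (x y : ZMod p) : Usl x * Usl y = Usl (x + y) := by
  ext i j
  fin_cases i <;> fin_cases j <;> simp [Usl_coe, Matrix.SpecialLinearGroup.coe_mul, Matrix.mul_apply, Fin.sum_univ_two, add_comm]

lemma Lsl_mul {p : ℕ} (x y : ZMod p) : Lsl x * Lsl y = Lsl (x + y) := by
  ext i j
  fin_cases i <;> fin_cases j <;> simp [Lsl_coe, Matrix.SpecialLinearGroup.coe_mul, Matrix.mul_apply, Fin.sum_univ_two, add_comm]

lemma Usl_zero {p : ℕ} : Usl (0 : ZMod p) = 1 := by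
  ext i j
  fin_cases i <;> fin_cases j <;> simp [Usl_coe]

lemma Lsl_zero {p : ℕ} : Lsl (0 : ZMod p) = 1 := by
  ext i j
  fin_cases i <;> fin_cases j <;> simp [Lsl_coe]

lemma Usl_mem {p : ℕ} [Fact p.Prime] (K : Subgroup SL(2, ZMod p)) {d : ZMod p} (hd : d ≠ 0)
    (h : Usl d ∈ K) (x : ZMod p) : Usl x ∈ K := by
  have key : ∀ n : ℕ, Usl ((n : ZMod p) * d) ∈ K := by
    intro n
    induction n with
    | zero => simpa [Usl_zero] using K.one_mem
    | succ n ih =>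
      have := K.mul_mem ih h
      rw [Usl_mul] at this
      convert this using 2
      push_cast; ring
  have := key (x / d).val
  rwa [ZMod.natCast_zmod_val, div_mul_cancel₀ _ hd] at this

lemma Lsl_mem {p : ℕ} [Fact p.Prime] (K : Subgroup SL(2, ZMod p)) {d : ZMod p} (hd : d ≠ 0)
    (h : Lsl d ∈ K) (x : ZMod p) : Lsl x ∈ K := by
  have key : ∀ n : ℕ, Lsl ((n : ZMod p) * d) ∈ K := by
    intro n
    induction n with
    | zero => simpa [Lsl_zero] using K.one_mem
    | succ n ih =>
      have := K.mul_mem ih h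
      rw [Lsl_mul] at this
      convert this using 2
      push_cast; ring
  have := key (x / d).val
  rwa [ZMod.natCast_zmod_val, div_mul_cancel₀ _ hd] at this

lemma mem_of_UL {p : ℕ} [Fact p.Prime] (K : Subgroup SL(2, ZMod p))
    (hU : ∀ x, Usl x ∈ K) (hL : ∀ x, Lsl x ∈ K) (M : SL(2, ZMod p)) : M ∈ K := by
  have main : ∀ M : SL(2, ZMod p), M 1 0 ≠ 0 → M ∈ K := by
    intro M hc
    have hdet := M.det_coe
    rw [Matrix.det_fin_two] at hdet
    have : M = Usl ((M 0 0 - 1) / M 1 0) * Lsl (M 1 0) * Usl ((M 1 1 - 1) / M 1 0) := by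
      ext i j
      fin_cases i <;> fin_cases j <;>
        simp [Usl_coe, Lsl_coe, Matrix.SpecialLinearGroup.coe_mul, Matrix.mul_apply, Fin.sum_univ_two] <;> field_simp <;>
        first | ring1 | linear_combination (-1 : ZMod p) * hdet | linear_combination hdet
    rw [this]
    exact K.mul_mem (K.mul_mem (hU _) (hL _)) (hU _)
  by_cases hc : M 1 0 = 0
  · have h1 : Lsl 1 * M ∈ K := by
      apply main
      have hdet := M.det_coe
      rw [Matrix.det_fin_two, hc] at hdet
      intro h0
      simp [Lsl_coe, Matrix.SpecialLinearGroup.coe_mul, Matrix.mul_apply, Fin.sum_univ_two, hc] at h0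
      simp [h0] at hdet
    exact (K.mul_mem_cancel_left (hL 1)).1 h1
  · exact main M hc

lemma T_mul_inv {p : ℕ} (a b : ZMod p) : Tsl a * (Tsl b)⁻¹ = Usl (a - b) := by
  rw [mul_inv_eq_iff_eq_mul]
  ext i j
  fin_cases i <;> fin_cases j <;> simp [Usl_coe, Tsl_coe, Matrix.SpecialLinearGroup.coe_mul, Matrix.mul_apply, Fin.sum_univ_two]

lemma T_inv_mul {p : ℕ} (a b : ZMod p) : (Tsl a)⁻¹ * Tsl b = Lsl (a - b) := by
  rw [inv_mul_eq_iff_eq_mul]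
  ext i j
  fin_cases i <;> fin_cases j <;> simp [Lsl_coe, Tsl_coe, Matrix.SpecialLinearGroup.coe_mul, Matrix.mul_apply, Fin.sum_univ_two]

lemma T_conj_U {p : ℕ} (a d : ZMod p) :
    Tsl a * Usl d = Usl a * Lsl (-d) * Usl (-a) * Tsl a := by
  ext i j
  fin_cases i <;> fin_cases j <;>
    simp [Usl_coe, Lsl_coe, Tsl_coe, Matrix.SpecialLinearGroup.coe_mul, Matrix.mul_apply, Fin.sum_univ_two] <;> ring

lemma T_conj_L {p : ℕ} (a d : ZMod p) :
    Lsl d * Tsl a = Tsl a * (Lsl a * Usl (-d) * Lsl (-a)) := by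
  ext i j
  fin_cases i <;> fin_cases j <;>
    simp [Usl_coe, Lsl_coe, Tsl_coe, Matrix.SpecialLinearGroup.coe_mul, Matrix.mul_apply, Fin.sum_univ_two] <;> ring

lemma comap_top {p : ℕ} (H : Subgroup PSL(2, ZMod p))
    (h : ∀ M : SL(2, ZMod p), (QuotientGroup.mk M : PSL(2, ZMod p)) ∈ H) : H = ⊤ := by
  rw [eq_top_iff]
  intro x _
  induction x using QuotientGroup.induction_on with
  | H M => exact h M

lemma gen1 {p : ℕ} [Fact p.Prime] (K : Subgroup SL(2, ZMod p)) (a b : ZMod p) (hab : a - b ≠ 0)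
    (h1 : Tsl a * Tsl a * (Tsl a)⁻¹ * (Tsl b)⁻¹ ∈ K)
    (h2 : Tsl a * Tsl a * (Tsl b)⁻¹ * (Tsl a)⁻¹ ∈ K) (M : SL(2, ZMod p)) : M ∈ K := by
  rw [mul_inv_cancel_right, T_mul_inv] at h1
  have hU := Usl_mem K hab h1
  rw [mul_assoc (Tsl a), T_mul_inv, T_conj_U, mul_inv_cancel_right,
    K.mul_mem_cancel_right (hU _), K.mul_mem_cancel_left (hU _)] at h2
  exact mem_of_UL K hU (Lsl_mem K (neg_ne_zero.2 hab) h2) M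

lemma gen2 {p : ℕ} [Fact p.Prime] (K : Subgroup SL(2, ZMod p)) (a b : ZMod p) (hab : a - b ≠ 0)
    (h1 : (Tsl a)⁻¹ * (Tsl a)⁻¹ * Tsl a * Tsl b ∈ K)
    (h2 : (Tsl a)⁻¹ * (Tsl a)⁻¹ * Tsl b * Tsl a ∈ K) (M : SL(2, ZMod p)) : M ∈ K := by
  rw [inv_mul_cancel_right, T_inv_mul] at h1
  have hL := Lsl_mem K hab h1
  rw [mul_assoc (Tsl a)⁻¹, T_inv_mul, mul_assoc, T_conj_L, inv_mul_cancel_left,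
    K.mul_mem_cancel_right (hL _), K.mul_mem_cancel_left (hL _)] at h2
  exact mem_of_UL K (Usl_mem K (neg_ne_zero.2 hab) h2) hL M

/-- Let `v, v'` be two distinct integers, let `p ≥ max (5, |v - v'| + 1)` be a
prime, and let `λ ∈ 𝔽_p`.  Then, with `S = {T(λ-v), T(λ-v')} ⊆ PSL₂(p)`, the subgroup generated
by `S²S⁻²` is all of `PSL₂(p)`, and likewise for the subgroup generated by `S⁻²S²`. -/
theorem psl2_generation_S2 (v v' : ℤ) (hvv' : v ≠ v') (p : ℕ) (hp : p.Prime)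
    (hpC : max 5 ((v - v').natAbs + 1) ≤ p) (lam : ZMod p) :
    (Subgroup.closure {x : PSL(2, ZMod p) |
        ∃ g₁ ∈ ({Tbar (lam - (v : ZMod p)), Tbar (lam - (v' : ZMod p))} : Set PSL(2, ZMod p)),
        ∃ g₂ ∈ ({Tbar (lam - (v : ZMod p)), Tbar (lam - (v' : ZMod p))} : Set PSL(2, ZMod p)),
        ∃ g₃ ∈ ({Tbar (lam - (v : ZMod p)), Tbar (lam - (v' : ZMod p))} : Set PSL(2, ZMod p)),
        ∃ g₄ ∈ ({Tbar (lam - (v : ZMod p)), Tbar (lam - (v' : ZMod p))} : Set PSL(2, ZMod p)),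
          x = g₁ * g₂ * g₃⁻¹ * g₄⁻¹} = ⊤) ∧
    (Subgroup.closure {x : PSL(2, ZMod p) |
        ∃ g₁ ∈ ({Tbar (lam - (v : ZMod p)), Tbar (lam - (v' : ZMod p))} : Set PSL(2, ZMod p)),
        ∃ g₂ ∈ ({Tbar (lam - (v : ZMod p)), Tbar (lam - (v' : ZMod p))} : Set PSL(2, ZMod p)),
        ∃ g₃ ∈ ({Tbar (lam - (v : ZMod p)), Tbar (lam - (v' : ZMod p))} : Set PSL(2, ZMod p)),
        ∃ g₄ ∈ ({Tbar (lam - (v : ZMod p)), Tbar (lam - (v' : ZMod p))} : Set PSL(2, ZMod p)),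
          x = g₁⁻¹ * g₂⁻¹ * g₃ * g₄} = ⊤) := by
  have : Fact p.Prime := ⟨hp⟩
  have hab : (lam - (v : ZMod p)) - (lam - (v' : ZMod p)) ≠ 0 := by
    intro h
    have h0 : ((v - v' : ℤ) : ZMod p) = 0 := by
      push_cast
      linear_combination -h
    rw [ZMod.intCast_zmod_eq_zero_iff_dvd] at h0
    have h1 := Nat.le_of_dvd (by omega) (Int.natCast_dvd.1 h0)
    omega
  constructor
  · apply comap_top
    intro M
    refine gen1 (Subgroup.comap (QuotientGroup.mk' _) (Subgroup.closure _)) _ _ hab ?_ ?_ M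
    · exact Subgroup.subset_closure ⟨_, Or.inl rfl, _, Or.inl rfl, _, Or.inl rfl, _, Or.inr rfl, rfl⟩
    · exact Subgroup.subset_closure ⟨_, Or.inl rfl, _, Or.inl rfl, _, Or.inr rfl, _, Or.inl rfl, rfl⟩
  · apply comap_top
    intro M
    refine gen2 (Subgroup.comap (QuotientGroup.mk' _) (Subgroup.closure _)) _ _ hab ?_ ?_ M
    · exact Subgroup.subset_closure ⟨_, Or.inl rfl, _, Or.inl rfl, _, Or.inl rfl, _, Or.inr rfl, rfl⟩
    · exact Subgroup.subset_closure ⟨_, Or.inl rfl, _, Or.inl rfl, _, Or.inr rfl, _, Or.inl rfl, rfl⟩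

end
end

section
/- Let w, w′ be nonzero integers with w ≠ ±w′. There exists a constant C(w, w′) such that for every prime p ≥ C(w, w′) and every λ ∈ 𝔽_p \ {0}, letting S = { T̃(λ, w), T̃(λ, w′) } ⊆ PSL₂(p), the subgroup generated by S³S^{−3} = { g₁g₂g₃g₄⁻¹g₅⁻¹g₆⁻¹ : g_i ∈ S } equals PSL₂(p), and likewise the subgroup generated by S^{−3}S³ = { g₁⁻¹g₂⁻¹g₃⁻¹g₄g₅g₆ : g_i ∈ S } equals PSL₂(p). -/
open Matrix
open scoped MatrixGroups

noncomputable section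

/-- The matrix `T̃(λ, w) = [[λ/w, -w], [1/w, 0]]` as an element of `SL(2, ZMod p)`.
(When `w` is invertible mod `p` this matrix has determinant one; otherwise we use the
junk value `1`, which does not occur in the statements below, where `p` is large compared
to `w`.) -/
def Ttil {p : ℕ} (lam w : ZMod p) : SL(2, ZMod p) :=
  if h : (!![lam * w⁻¹, -w; w⁻¹, 0] : Matrix (Fin 2) (Fin 2) (ZMod p)).det = 1 then
    ⟨!![lam * w⁻¹, -w; w⁻¹, 0], h⟩
  else 1

/-- The image of `T̃(λ, w)` in `PSL(2, ZMod p)`. -/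
def Ttilbar {p : ℕ} (lam w : ZMod p) : PSL(2, ZMod p) :=
  QuotientGroup.mk (Ttil lam w)

theorem core_aux {p : ℕ} [Fact p.Prime] (K : Subgroup SL(2, ZMod p)) (X Y M : SL(2, ZMod p))
    (hX : X ∈ K) (hY : Y ∈ K) (hM : M ∈ K)
    (hX01 : X 0 1 = 0) (hX10 : X 1 0 = 0) (hX00 : X 0 0 ^ 2 ≠ 1)
    (hY01 : Y 0 1 = 0) (hY10 : Y 1 0 ≠ 0) (hM01 : M 0 1 ≠ 0) : K = ⊤ := by
  obtain ⟨L, Lc⟩ : ∃ f : ZMod p → SL(2, ZMod p),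
      ∀ t, (f t : Matrix (Fin 2) (Fin 2) (ZMod p)) = !![1, 0; t, 1] :=
    ⟨fun t => ⟨!![1, 0; t, 1], by simp [Matrix.det_fin_two]⟩, fun t => rfl⟩
  obtain ⟨U, Uc⟩ : ∃ f : ZMod p → SL(2, ZMod p),
      ∀ t, (f t : Matrix (Fin 2) (Fin 2) (ZMod p)) = !![1, t; 0, 1] :=
    ⟨fun t => ⟨!![1, t; 0, 1], by simp [Matrix.det_fin_two]⟩, fun t => rfl⟩
  have hdX := X.det_coe
  have hdY := Y.det_coe
  rw [Matrix.det_fin_two] at hdX hdY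
  have hX0 : X 0 0 ≠ 0 := by
    intro h; rw [h, hX01] at hdX; simp at hdX
  have hY0 : Y 0 0 ≠ 0 := by
    intro h; rw [h, hY01] at hdY; simp at hdY
  rw [hX01] at hdX
  rw [hY01] at hdY
  have hX11 : X 1 1 = (X 0 0)⁻¹ := by
    field_simp; linear_combination hdX
  have hY11 : Y 1 1 = (Y 0 0)⁻¹ := by
    field_simp; linear_combination hdY
  -- the commutator is a nontrivial lower unipotent
  obtain ⟨t, ht, hLt⟩ : ∃ t : ZMod p, t ≠ 0 ∧ L t ∈ K := by
    refine ⟨Y 1 0 * (Y 0 0)⁻¹ * ((X 0 0)⁻¹ ^ 2 - 1) * 1, ?_, ?_⟩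
    · have : (X 0 0)⁻¹ ^ 2 - 1 ≠ 0 := by
        intro h
        apply hX00
        field_simp at h
        linear_combination -h
      simp only [mul_one]
      exact mul_ne_zero (mul_ne_zero hY10 (inv_ne_zero hY0)) this
    · have : X * Y * X⁻¹ * Y⁻¹ ∈ K :=
        K.mul_mem (K.mul_mem (K.mul_mem hX hY) (K.inv_mem hX)) (K.inv_mem hY)
      convert this using 1
      ext i j
      fin_cases i <;> fin_cases j <;>
        simp [Lc, Matrix.mul_apply, Fin.sum_univ_two, Matrix.SpecialLinearGroup.coe_inv,
          Matrix.adjugate_fin_two, hX01, hX10, hX11, hY01, hY11] <;> field_simp <;> ring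
  have hLpow : ∀ (n : ℕ) (t : ZMod p), L t ^ n = L (n * t) := by
    intro n t
    induction n with
    | zero => ext i j; fin_cases i <;> fin_cases j <;> simp [Lc]
    | succ k ih =>
      rw [pow_succ, ih]
      ext i j
      fin_cases i <;> fin_cases j <;>
        simp [Lc, Matrix.mul_apply, Fin.sum_univ_two]
      ring
  have hL : ∀ s, L s ∈ K := by
    intro s
    have h := K.pow_mem hLt (s / t).val
    rw [hLpow, ZMod.natCast_val, ZMod.cast_id, div_mul_cancel₀ _ ht] at h
    exact h
  obtain ⟨b, hMb⟩ : ∃ b, M 0 1 = b := ⟨_, rfl⟩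
  have hb : b ≠ 0 := hMb ▸ hM01
  obtain ⟨W, Wc⟩ : ∃ W : SL(2, ZMod p),
      (W : Matrix (Fin 2) (Fin 2) (ZMod p)) = !![0, b; -b⁻¹, 0] :=
    ⟨⟨!![0, b; -b⁻¹, 0], by simp [Matrix.det_fin_two, hb]⟩, rfl⟩
  have hdM := M.det_coe
  rw [Matrix.det_fin_two, hMb] at hdM
  have hW : W ∈ K := by
    have : L (-(M 1 1) / b) * M * L (-(M 0 0) / b) ∈ K :=
      K.mul_mem (K.mul_mem (hL _) hM) (hL _)
    convert this using 1
    ext i j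
    fin_cases i <;> fin_cases j <;>
      simp [Lc, Wc, hMb, Matrix.mul_apply, Fin.sum_univ_two, Matrix.vecMul, dotProduct] <;>
      (try field_simp) <;>
      first | ring1 | linear_combination hdM | linear_combination -hdM
  have hU : ∀ s, U s ∈ K := by
    intro s
    have : W * L (-s / b ^ 2) * W⁻¹ ∈ K :=
      K.mul_mem (K.mul_mem hW (hL _)) (K.inv_mem hW)
    convert this using 1
    ext i j
    fin_cases i <;> fin_cases j <;>
      simp [Lc, Uc, Wc, Matrix.mul_apply, Fin.sum_univ_two, Matrix.SpecialLinearGroup.coe_inv,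
        Matrix.adjugate_fin_two] <;> field_simp
  have key : ∀ g : SL(2, ZMod p), g 0 1 ≠ 0 → g ∈ K := by
    intro g hg
    have hdg := g.det_coe
    rw [Matrix.det_fin_two] at hdg
    have : L ((g 1 1 - 1) / g 0 1) * U (g 0 1) * L ((g 0 0 - 1) / g 0 1) ∈ K :=
      K.mul_mem (K.mul_mem (hL _) (hU _)) (hL _)
    convert this using 1
    ext i j
    fin_cases i <;> fin_cases j <;>
      simp [Lc, Uc, Matrix.mul_apply, Fin.sum_univ_two] <;> field_simp <;>
      first | ring1 | linear_combination hdg | linear_combination -hdg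
  rw [eq_top_iff]
  intro g _
  by_cases hg : g 0 1 = 0
  · have hdg := g.det_coe
    rw [Matrix.det_fin_two, hg] at hdg
    have h0 : g 0 0 ≠ 0 := by
      intro h; rw [h] at hdg; simp at hdg
    have h1 : g * U 1 ∈ K := by
      apply key
      simpa [Uc, Matrix.mul_apply, Fin.sum_univ_two, hg] using h0
    exact (K.mul_mem_cancel_right (hU 1)).1 h1
  · exact key g hg

theorem core_R {p : ℕ} [Fact p.Prime] (K : Subgroup SL(2, ZMod p)) (l v v' : ZMod p)
    (hl : l ≠ 0) (hv : v ≠ 0) (hv' : v' ≠ 0) (hvv : v ^ 2 ≠ v' ^ 2) (R R' : SL(2, ZMod p))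
    (hR : (R : Matrix (Fin 2) (Fin 2) (ZMod p)) = !![0, -v; v⁻¹, l * v⁻¹])
    (hR' : (R' : Matrix (Fin 2) (Fin 2) (ZMod p)) = !![0, -v'; v'⁻¹, l * v'⁻¹])
    (h1 : R * R'⁻¹ ∈ K) (h2 : R * (R * R'⁻¹) * R⁻¹ ∈ K)
    (h3 : R * (R * (R * R'⁻¹) * R⁻¹) * R⁻¹ ∈ K) : K = ⊤ := by
  have hX : ((R * R'⁻¹ : SL(2, ZMod p)) : Matrix (Fin 2) (Fin 2) (ZMod p))
      = !![v * v'⁻¹, 0; 0, v' * v⁻¹] := by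
    ext i j
    fin_cases i <;> fin_cases j <;>
      simp [hR, hR', Matrix.mul_apply, Fin.sum_univ_two, Matrix.SpecialLinearGroup.coe_inv,
        Matrix.adjugate_fin_two] <;> field_simp <;> ring
  have hY : ((R * (R * R'⁻¹) * R⁻¹ : SL(2, ZMod p)) : Matrix (Fin 2) (Fin 2) (ZMod p))
      = !![v' * v⁻¹, 0; l * (v * v'⁻¹ - v' * v⁻¹) * (v⁻¹) ^ 2, v * v'⁻¹] := by
    rw [Matrix.SpecialLinearGroup.coe_mul, Matrix.SpecialLinearGroup.coe_mul, hX]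
    ext i j
    fin_cases i <;> fin_cases j <;>
      simp [hR, hv, Matrix.mul_apply, Fin.sum_univ_two, Matrix.SpecialLinearGroup.coe_inv,
        Matrix.adjugate_fin_two] <;> field_simp <;> ring
  have hne : v * v'⁻¹ - v' * v⁻¹ ≠ 0 := by
    intro h
    apply hvv
    field_simp at h
    linear_combination h
  refine core_aux K _ _ _ h1 h2 h3 ?_ ?_ ?_ ?_ ?_ ?_
  · rw [hX]; simp
  · rw [hX]; simp
  · rw [hX]
    intro h
    apply hvv
    change (v * v'⁻¹) ^ 2 = 1 at h
    field_simp at h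
    linear_combination h
  · rw [hY]; simp
  · rw [hY]; simp [hl, hv, hne]
  · rw [Matrix.SpecialLinearGroup.coe_mul, Matrix.SpecialLinearGroup.coe_mul, hY]
    have : l * (v * v'⁻¹ - v' * v⁻¹) ≠ 0 := mul_ne_zero hl hne
    simp [hR, Matrix.mul_apply, Fin.sum_univ_two, Matrix.SpecialLinearGroup.coe_inv,
        Matrix.adjugate_fin_two, hl, hv, hne]

theorem Ttil_coe {p : ℕ} [Fact p.Prime] (l v : ZMod p) (hv : v ≠ 0) :
    ((Ttil l v : SL(2, ZMod p)) : Matrix (Fin 2) (Fin 2) (ZMod p)) = !![l * v⁻¹, -v; v⁻¹, 0] := by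
  have hd : (!![l * v⁻¹, -v; v⁻¹, 0] : Matrix (Fin 2) (Fin 2) (ZMod p)).det = 1 := by
    simp [Matrix.det_fin_two, hv]
  have h : (Ttil l v : SL(2, ZMod p)) = ⟨!![l * v⁻¹, -v; v⁻¹, 0], hd⟩ := dif_pos hd
  rw [h]

/-- Let `w, w'` be nonzero integers with `w ≠ ±w'`.  There exists a constant
`C(w, w')` such that for every prime `p ≥ C(w, w')` and every `0 ≠ λ ∈ 𝔽_p`, letting
`S = {T̃(λ, w), T̃(λ, w')} ⊆ PSL₂(p)`, the subgroup generated by `S³S⁻³` equals `PSL₂(p)`,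
and likewise the subgroup generated by `S⁻³S³` equals `PSL₂(p)`. -/
theorem psl2_generation_dyson (w w' : ℤ) (hw : w ≠ 0) (hw' : w' ≠ 0) (hww' : w ≠ w')
    (hww'' : w ≠ -w') :
    ∃ C : ℕ, ∀ p : ℕ, p.Prime → C ≤ p → ∀ lam : ZMod p, lam ≠ 0 →
      (Subgroup.closure {x : PSL(2, ZMod p) |
          ∃ g₁ ∈ ({Ttilbar lam (w : ZMod p), Ttilbar lam (w' : ZMod p)} : Set PSL(2, ZMod p)),
          ∃ g₂ ∈ ({Ttilbar lam (w : ZMod p), Ttilbar lam (w' : ZMod p)} : Set PSL(2, ZMod p)),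
          ∃ g₃ ∈ ({Ttilbar lam (w : ZMod p), Ttilbar lam (w' : ZMod p)} : Set PSL(2, ZMod p)),
          ∃ g₄ ∈ ({Ttilbar lam (w : ZMod p), Ttilbar lam (w' : ZMod p)} : Set PSL(2, ZMod p)),
          ∃ g₅ ∈ ({Ttilbar lam (w : ZMod p), Ttilbar lam (w' : ZMod p)} : Set PSL(2, ZMod p)),
          ∃ g₆ ∈ ({Ttilbar lam (w : ZMod p), Ttilbar lam (w' : ZMod p)} : Set PSL(2, ZMod p)),
            x = g₁ * g₂ * g₃ * g₄⁻¹ * g₅⁻¹ * g₆⁻¹} = ⊤) ∧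
      (Subgroup.closure {x : PSL(2, ZMod p) |
          ∃ g₁ ∈ ({Ttilbar lam (w : ZMod p), Ttilbar lam (w' : ZMod p)} : Set PSL(2, ZMod p)),
          ∃ g₂ ∈ ({Ttilbar lam (w : ZMod p), Ttilbar lam (w' : ZMod p)} : Set PSL(2, ZMod p)),
          ∃ g₃ ∈ ({Ttilbar lam (w : ZMod p), Ttilbar lam (w' : ZMod p)} : Set PSL(2, ZMod p)),
          ∃ g₄ ∈ ({Ttilbar lam (w : ZMod p), Ttilbar lam (w' : ZMod p)} : Set PSL(2, ZMod p)),
          ∃ g₅ ∈ ({Ttilbar lam (w : ZMod p), Ttilbar lam (w' : ZMod p)} : Set PSL(2, ZMod p)),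
          ∃ g₆ ∈ ({Ttilbar lam (w : ZMod p), Ttilbar lam (w' : ZMod p)} : Set PSL(2, ZMod p)),
            x = g₁⁻¹ * g₂⁻¹ * g₃⁻¹ * g₄ * g₅ * g₆} = ⊤) := by
  refine ⟨(w * w' * (w ^ 2 - w' ^ 2)).natAbs + 1, ?_⟩
  intro p hp hC lam hlam
  haveI : Fact p.Prime := ⟨hp⟩
  have hsq : w ^ 2 - w' ^ 2 ≠ 0 := by
    intro h
    rcases sq_eq_sq_iff_eq_or_eq_neg.1 (sub_eq_zero.1 h) with h | h
    · exact hww' h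
    · exact hww'' h
  have hprod : w * w' * (w ^ 2 - w' ^ 2) ≠ 0 := mul_ne_zero (mul_ne_zero hw hw') hsq
  have hcast : ((w * w' * (w ^ 2 - w' ^ 2) : ℤ) : ZMod p) ≠ 0 := by
    intro h
    rw [ZMod.intCast_zmod_eq_zero_iff_dvd] at h
    have h2 := Int.natAbs_dvd_natAbs.2 h
    rw [Int.natAbs_natCast] at h2
    have := Nat.le_of_dvd (Int.natAbs_pos.2 hprod) h2
    omega
  push_cast at hcast
  generalize (w : ZMod p) = v at hcast ⊢
  generalize (w' : ZMod p) = v' at hcast ⊢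
  have hv : v ≠ 0 := fun h => hcast (by simp [h])
  have hv' : v' ≠ 0 := fun h => hcast (by simp [h])
  have hvv : v ^ 2 ≠ v' ^ 2 := fun h => hcast (by simp [h])
  have red : ∀ H : Subgroup PSL(2, ZMod p),
      H.comap (QuotientGroup.mk' (Subgroup.center SL(2, ZMod p))) = ⊤ → H = ⊤ := by
    intro H h
    rw [eq_top_iff]
    intro x _
    obtain ⟨y, rfl⟩ := QuotientGroup.mk'_surjective _ x
    have : y ∈ H.comap (QuotientGroup.mk' (Subgroup.center SL(2, ZMod p))) := by
      rw [h]; trivial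
    exact this
  constructor
  · apply red
    set K := Subgroup.comap (QuotientGroup.mk' (Subgroup.center SL(2, ZMod p))) _ with hK
    obtain ⟨P, Pc⟩ : ∃ P : SL(2, ZMod p),
        (P : Matrix (Fin 2) (Fin 2) (ZMod p)) = !![1, lam; 0, 1] :=
      ⟨⟨!![1, lam; 0, 1], by simp [Matrix.det_fin_two]⟩, rfl⟩
    have hKP : K.comap (MulAut.conj P).toMonoidHom = ⊤ := by
      refine core_R _ lam v v' hlam hv hv' hvv (P⁻¹ * Ttil lam v * P) (P⁻¹ * Ttil lam v' * P)
        ?_ ?_ ?_ ?_ ?_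
      · rw [Matrix.SpecialLinearGroup.coe_mul, Matrix.SpecialLinearGroup.coe_mul, Ttil_coe _ _ hv]
        ext i j
        fin_cases i <;> fin_cases j <;>
          simp [Pc, Matrix.mul_apply, Fin.sum_univ_two, Matrix.SpecialLinearGroup.coe_inv,
            Matrix.adjugate_fin_two] <;> ring
      · rw [Matrix.SpecialLinearGroup.coe_mul, Matrix.SpecialLinearGroup.coe_mul, Ttil_coe _ _ hv']
        ext i j
        fin_cases i <;> fin_cases j <;>
          simp [Pc, Matrix.mul_apply, Fin.sum_univ_two, Matrix.SpecialLinearGroup.coe_inv,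
            Matrix.adjugate_fin_two] <;> ring
      all_goals
        rw [Subgroup.mem_comap, hK, Subgroup.mem_comap]
        apply Subgroup.subset_closure
      · refine ⟨Ttilbar lam v, by simp, Ttilbar lam v, by simp, Ttilbar lam v, by simp,
          Ttilbar lam v, by simp, Ttilbar lam v, by simp, Ttilbar lam v', by simp, ?_⟩
        simp only [MulEquiv.toMonoidHom_eq_coe, MonoidHom.coe_coe, MulAut.conj_apply, map_mul,
          map_inv, QuotientGroup.mk'_apply, Ttilbar]
        group
      · refine ⟨Ttilbar lam v, by simp, Ttilbar lam v, by simp, Ttilbar lam v, by simp,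
          Ttilbar lam v, by simp, Ttilbar lam v', by simp, Ttilbar lam v, by simp, ?_⟩
        simp only [MulEquiv.toMonoidHom_eq_coe, MonoidHom.coe_coe, MulAut.conj_apply, map_mul,
          map_inv, QuotientGroup.mk'_apply, Ttilbar]
        group
      · refine ⟨Ttilbar lam v, by simp, Ttilbar lam v, by simp, Ttilbar lam v, by simp,
          Ttilbar lam v', by simp, Ttilbar lam v, by simp, Ttilbar lam v, by simp, ?_⟩
        simp only [MulEquiv.toMonoidHom_eq_coe, MonoidHom.coe_coe, MulAut.conj_apply, map_mul,
          map_inv, QuotientGroup.mk'_apply, Ttilbar]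
        group
    rw [eq_top_iff]
    intro g _
    have : P⁻¹ * g * P ∈ K.comap (MulAut.conj P).toMonoidHom := by rw [hKP]; trivial
    rw [Subgroup.mem_comap] at this
    convert this using 1
    simp only [MulEquiv.toMonoidHom_eq_coe, MonoidHom.coe_coe, MulAut.conj_apply]
    group
  · apply red
    refine core_R _ (-lam) (-v) (-v') (neg_ne_zero.2 hlam) (neg_ne_zero.2 hv) (neg_ne_zero.2 hv')
      (by simpa using hvv) (Ttil lam v)⁻¹ (Ttil lam v')⁻¹ ?_ ?_ ?_ ?_ ?_
    · rw [Matrix.SpecialLinearGroup.coe_inv, Ttil_coe _ _ hv, Matrix.adjugate_fin_two]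
      simp [inv_neg]
    · rw [Matrix.SpecialLinearGroup.coe_inv, Ttil_coe _ _ hv', Matrix.adjugate_fin_two]
      simp [inv_neg]
    all_goals
      rw [Subgroup.mem_comap]
      apply Subgroup.subset_closure
    · refine ⟨Ttilbar lam v, by simp, Ttilbar lam v, by simp, Ttilbar lam v, by simp,
        Ttilbar lam v, by simp, Ttilbar lam v, by simp, Ttilbar lam v', by simp, ?_⟩
      simp only [map_mul, map_inv, QuotientGroup.mk'_apply, Ttilbar]
      group
    · refine ⟨Ttilbar lam v, by simp, Ttilbar lam v, by simp, Ttilbar lam v, by simp,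
        Ttilbar lam v, by simp, Ttilbar lam v', by simp, Ttilbar lam v, by simp, ?_⟩
      simp only [map_mul, map_inv, QuotientGroup.mk'_apply, Ttilbar]
      group
    · refine ⟨Ttilbar lam v, by simp, Ttilbar lam v, by simp, Ttilbar lam v, by simp,
        Ttilbar lam v', by simp, Ttilbar lam v, by simp, Ttilbar lam v, by simp, ?_⟩
      simp only [map_mul, map_inv, QuotientGroup.mk'_apply, Ttilbar]
      group

end
end

section
/- Let w, w′ be nonzero integers with w ≠ ±w′. There exists a constant C(w, w′) such that for every k ≥ 1, all primes p₁, …, p_k ≥ C(w, w′), and all λ₁ ∈ 𝔽_{p₁} \ {0}, …, λ_k ∈ 𝔽_{p_k} \ {0} with λ_i ≠ ±λ_j whenever p_i = p_j and i ≠ j, letting S = { (T̃(λ₁, w), …, T̃(λ_k, w)), (T̃(λ₁, w′), …, T̃(λ_k, w′)) } ⊆ PSL₂(p₁) × ⋯ × PSL₂(p_k), the subgroup generated by S³S^{−3} = { g₁g₂g₃g₄⁻¹g₅⁻¹g₆⁻¹ : g_i ∈ S } equals the full product PSL₂(p₁) × ⋯ × PSL₂(p_k), and likewise for the subgroup generated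 by S^{−3}S³. -/
open Matrix
open scoped MatrixGroups

noncomputable section

namespace DysonAux

set_option linter.unusedSimpArgs false


lemma mulE {R : Type*} [CommRing R] (g h : SL(2, R)) (i j : Fin 2) :
    (g * h) i j = g i 0 * h 0 j + g i 1 * h 1 j := by
  rw [Matrix.SpecialLinearGroup.coe_mul, Matrix.mul_apply, Fin.sum_univ_two]

lemma inv00 {R : Type*} [CommRing R] (g : SL(2, R)) : g⁻¹ 0 0 = g 1 1 := by
  rw [Matrix.SpecialLinearGroup.coe_inv, Matrix.adjugate_fin_two]; rfl

lemma inv01 {R : Type*} [CommRing R] (g : SL(2, R)) : g⁻¹ 0 1 = - g 0 1 := by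
  rw [Matrix.SpecialLinearGroup.coe_inv, Matrix.adjugate_fin_two]; rfl

lemma inv10 {R : Type*} [CommRing R] (g : SL(2, R)) : g⁻¹ 1 0 = - g 1 0 := by
  rw [Matrix.SpecialLinearGroup.coe_inv, Matrix.adjugate_fin_two]; rfl

lemma inv11 {R : Type*} [CommRing R] (g : SL(2, R)) : g⁻¹ 1 1 = g 0 0 := by
  rw [Matrix.SpecialLinearGroup.coe_inv, Matrix.adjugate_fin_two]; rfl

lemma ext4 {R : Type*} [CommRing R] {g h : SL(2, R)} (h00 : g 0 0 = h 0 0) (h01 : g 0 1 = h 0 1)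
    (h10 : g 1 0 = h 1 0) (h11 : g 1 1 = h 1 1) : g = h := by
  ext i j
  fin_cases i <;> fin_cases j <;> assumption

variable {R : Type*} [CommRing R]

/-- Upper unipotent. -/
def uu (t : R) : SL(2, R) := ⟨!![1, t; 0, 1], by simp⟩

/-- Lower unipotent. -/
def ll (t : R) : SL(2, R) := ⟨!![1, 0; t, 1], by simp⟩

lemma uu00 (t : R) : uu t 0 0 = 1 := rfl

lemma uu01 (t : R) : uu t 0 1 = t := rfl

lemma uu10 (t : R) : uu t 1 0 = 0 := rfl

lemma uu11 (t : R) : uu t 1 1 = 1 := rfl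

lemma ll00 (t : R) : ll t 0 0 = 1 := rfl

lemma ll01 (t : R) : ll t 0 1 = 0 := rfl

lemma ll10 (t : R) : ll t 1 0 = t := rfl

lemma ll11 (t : R) : ll t 1 1 = 1 := rfl

lemma uu_add (a b : R) : uu (a + b) = uu a * uu b := by
  apply ext4 <;> simp [mulE, inv00, inv01, inv10, inv11,
      uu00, uu01, uu10, uu11, ll00, ll01, ll10, ll11, add_comm]

lemma ll_add (a b : R) : ll (a + b) = ll a * ll b := by
  apply ext4 <;> simp [mulE, inv00, inv01, inv10, inv11,
      uu00, uu01, uu10, uu11, ll00, ll01, ll10, ll11, add_comm]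

lemma uu_zero : uu (0 : R) = 1 := by
  ext i j; fin_cases i <;> fin_cases j <;> simp [uu]

lemma ll_zero : ll (0 : R) = 1 := by
  ext i j; fin_cases i <;> fin_cases j <;> simp [ll]

/-- `uu` as a hom. -/
def uuHom : Multiplicative R →* SL(2, R) where
  toFun t := uu t.toAdd
  map_one' := uu_zero
  map_mul' _ _ := uu_add _ _

/-- `ll` as a hom. -/
def llHom : Multiplicative R →* SL(2, R) where
  toFun t := ll t.toAdd
  map_one' := ll_zero
  map_mul' _ _ := ll_add _ _

lemma uu_zpow (a : R) (n : ℤ) : uu a ^ n = uu (n * a) := by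
  have := map_zpow (uuHom (R := R)) (Multiplicative.ofAdd a) n
  simp [uuHom, toAdd_zpow] at this
  exact this.symm

lemma ll_zpow (a : R) (n : ℤ) : ll a ^ n = ll (n * a) := by
  have := map_zpow (llHom (R := R)) (Multiplicative.ofAdd a) n
  simp [llHom, toAdd_zpow] at this
  exact this.symm

lemma uu_inv (a : R) : (uu a)⁻¹ = uu (-a) := by
  have := uu_zpow a (-1); simpa using this

lemma ll_inv (a : R) : (ll a)⁻¹ = ll (-a) := by
  have := ll_zpow a (-1); simpa using this

variable {F : Type*} [Field F]

/-- A subgroup of `SL₂` containing all elementary unipotents is everything. -/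
lemma eq_top_of_unip (N : Subgroup SL(2, F)) (hu : ∀ t, uu t ∈ N) (hl : ∀ t, ll t ∈ N) :
    N = ⊤ := by
  have key : ∀ g : SL(2, F), g 1 0 ≠ 0 → g ∈ N := by
    intro g hc
    have hdet : g 0 0 * g 1 1 - g 0 1 * g 1 0 = 1 := by
      have := g.det_coe; rwa [Matrix.det_fin_two] at this
    have : g = uu ((g 0 0 - 1) / g 1 0) * ll (g 1 0) * uu ((g 1 1 - 1) / g 1 0) := by
      apply ext4 <;> simp [mulE, inv00, inv01, inv10, inv11,
      uu00, uu01, uu10, uu11, ll00, ll01, ll10, ll11]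
      · field_simp; ring
      · field_simp; linear_combination -hdet
      · field_simp; ring
    rw [this]
    exact N.mul_mem (N.mul_mem (hu _) (hl _)) (hu _)
  rw [eq_top_iff]
  intro g _
  by_cases hc : g 1 0 = 0
  · have hdet : g 0 0 * g 1 1 - g 0 1 * g 1 0 = 1 := by
      have := g.det_coe; rwa [Matrix.det_fin_two] at this
    have ha : g 0 0 ≠ 0 := by
      intro h; rw [h, hc] at hdet; simp at hdet
    have h1 : ll 1 * g ∈ N := by
      apply key
      simpa [mulE, inv00, inv01, inv10, inv11, uu00, uu01, uu10, uu11, ll00, ll01, ll10, ll11, hc] using ha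
    exact (N.mul_mem_cancel_left (hl 1)).1 h1
  · exact key g hc

/-- diagonal. -/
def dd (q : F) (hq : q ≠ 0) : SL(2, F) := ⟨!![q, 0; 0, q⁻¹], by simp [hq]⟩

lemma dd00 (q : F) (hq : q ≠ 0) : dd q hq 0 0 = q := rfl

lemma dd01 (q : F) (hq : q ≠ 0) : dd q hq 0 1 = 0 := rfl

lemma dd10 (q : F) (hq : q ≠ 0) : dd q hq 1 0 = 0 := rfl

lemma dd11 (q : F) (hq : q ≠ 0) : dd q hq 1 1 = q⁻¹ := rfl

lemma dd_inv (q : F) (hq : q ≠ 0) : (dd q hq)⁻¹ = dd q⁻¹ (inv_ne_zero hq) := by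
  apply ext4 <;> simp [mulE, inv00, inv01, inv10, inv11,
      uu00, uu01, uu10, uu11, ll00, ll01, ll10, ll11, dd00, dd01, dd10, dd11]

/-- Weyl element. -/
def ww : SL(2, F) := ⟨!![0, -1; 1, 0], by simp⟩

lemma ww00  : (ww : SL(2, F)) 0 0 = 0 := rfl

lemma ww01  : (ww : SL(2, F)) 0 1 = -1 := rfl

lemma ww10  : (ww : SL(2, F)) 1 0 = 1 := rfl

lemma ww11  : (ww : SL(2, F)) 1 1 = 0 := rfl

lemma ww_conj (t : F) : ww * ll t * ww⁻¹ = uu (-t) := by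
  apply ext4 <;> simp [mulE, inv00, inv01, inv10, inv11,
      uu00, uu01, uu10, uu11, ll00, ll01, ll10, ll11, dd00, dd01,
      dd10, dd11, ww00, ww01, ww10, ww11]

/-- Normal subgroups of `SL₂(p)` containing an element with nonzero upper right entry. -/
lemma normal_eq_top {p : ℕ} [Fact p.Prime] (hp : 7 ≤ p) (N : Subgroup SL(2, ZMod p))
    (hN : N.Normal) (g : SL(2, ZMod p)) (hg : g ∈ N) (hb : g 0 1 ≠ 0) : N = ⊤ := by
  have cast_ne : ∀ m : ℕ, m ≠ 0 → m < 7 → (m : ZMod p) ≠ 0 := by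
    intro m h0 h7 h
    rw [ZMod.natCast_eq_zero_iff] at h
    have := Nat.le_of_dvd (by omega) h
    omega
  have h2 : (2 : ZMod p) ≠ 0 := by exact_mod_cast cast_ne 2 (by norm_num) (by norm_num)
  have h3 : (3 : ZMod p) ≠ 0 := by exact_mod_cast cast_ne 3 (by norm_num) (by norm_num)
  have h5 : (5 : ZMod p) ≠ 0 := by exact_mod_cast cast_ne 5 (by norm_num) (by norm_num)
  -- make the upper left entry vanish
  obtain ⟨g', hg', b, d, hb', e00, e01, e10, e11⟩ : ∃ g' ∈ N, ∃ b d : ZMod p, b ≠ 0 ∧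
      g' 0 0 = 0 ∧ g' 0 1 = b ∧ g' 1 0 = -b⁻¹ ∧ g' 1 1 = d := by
    refine ⟨ll (g 0 0 / g 0 1) * g * (ll (g 0 0 / g 0 1))⁻¹, hN.conj_mem g hg _, g 0 1,
      g 0 0 + g 1 1, hb, ?_⟩
    have hdet : g 0 0 * g 1 1 - g 0 1 * g 1 0 = 1 := by
      have := g.det_coe; rwa [Matrix.det_fin_two] at this
    rw [ll_inv]
    refine ⟨?_, ?_, ?_, ?_⟩ <;> simp [mulE, inv00, inv01, inv10, inv11,
      uu00, uu01, uu10, uu11, ll00, ll01, ll10, ll11] <;> field_simp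
    · ring
    · linear_combination -hdet
  have hv : dd 2 h2 * g' * (dd 2 h2)⁻¹ * g'⁻¹ ∈ N :=
    N.mul_mem (hN.conj_mem _ hg' _) (N.inv_mem hg')
  obtain ⟨v, hvN, c, f00, f01, f10, f11⟩ : ∃ v ∈ N, ∃ c : ZMod p,
      v 0 0 = 4 ∧ v 0 1 = 0 ∧ v 1 0 = c ∧ v 1 1 = 4⁻¹ := by
    refine ⟨_, hv, d / b - d / (4 * b), ?_⟩
    rw [dd_inv]
    have h4 : (4 : ZMod p) ≠ 0 := by
      have : (4 : ZMod p) = 2 * 2 := by norm_num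
      rw [this]; exact mul_ne_zero h2 h2
    have h42 : (4 : ZMod p) = 2 * 2 := by norm_num
    rw [h42]
    refine ⟨?_, ?_, ?_, ?_⟩ <;> simp [mulE, inv00, inv01, inv10, inv11,
      uu00, uu01, uu10, uu11, ll00, ll01, ll10, ll11, dd00, dd01,
      dd10, dd11, ww00, ww01, ww10, ww11, e00, e01, e10, e11] <;> field_simp
    ring
  have h4 : (4 : ZMod p) ≠ 0 := by
    have : (4 : ZMod p) = 2 * 2 := by norm_num
    rw [this]; exact mul_ne_zero h2 h2
  have hl : ll ((16 : ZMod p)⁻¹ - 1) ∈ N := by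
    have h1 : v * (ll 1 * v⁻¹ * (ll 1)⁻¹) ∈ N :=
      N.mul_mem hvN (hN.conj_mem _ (N.inv_mem hvN) _)
    convert h1 using 1
    rw [ll_inv]
    have h16 : (16 : ZMod p) = 4 * 4 := by norm_num
    rw [h16]
    apply ext4 <;> simp [mulE, inv00, inv01, inv10, inv11,
      uu00, uu01, uu10, uu11, ll00, ll01, ll10, ll11, f00, f01, f10, f11, h4] <;> field_simp
    ring
  have hm : ((16 : ZMod p)⁻¹ - 1) ≠ 0 := by
    have h16 : (16 : ZMod p) ≠ 0 := by
      have : (16 : ZMod p) = 4 * 4 := by norm_num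
      rw [this]; exact mul_ne_zero h4 h4
    intro h
    have h' : (16 : ZMod p)⁻¹ = 1 := by linear_combination h
    have h'' : (16 : ZMod p) = 1 := inv_eq_one.1 h'
    have : (3 : ZMod p) * 5 = 0 := by linear_combination h''
    exact mul_ne_zero h3 h5 this
  have hlt : ∀ t, ll t ∈ N := by
    intro t
    obtain ⟨n, hn⟩ := ZMod.intCast_surjective (t / ((16 : ZMod p)⁻¹ - 1))
    have := N.zpow_mem hl n
    rw [ll_zpow, hn, div_mul_cancel₀ _ hm] at this
    exact this
  refine eq_top_of_unip N (fun t => ?_) hlt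
  have := hN.conj_mem _ (hlt (-t)) ww
  rwa [ww_conj, neg_neg] at this

/-- Hall-type argument. -/
lemma prod_eq_top {k : ℕ} (p : Fin k → ℕ) [∀ i, Fact (p i).Prime] (hp : ∀ i, 7 ≤ p i)
    (K : Subgroup (∀ i, SL(2, ZMod (p i))))
    (hsurj : ∀ i, ∀ g : SL(2, ZMod (p i)), ∃ x ∈ K, x i = g)
    (hpair : ∀ i j, i ≠ j → ∃ x ∈ K, x j = 1 ∧ x i 0 1 ≠ 0) : K = ⊤ := by
  -- the subgroup of `i`-th coordinates of elements of `K` trivial along `s`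
  let N : (i : Fin k) → Finset (Fin k) → Subgroup SL(2, ZMod (p i)) := fun i s =>
    { carrier := {g | ∃ x ∈ K, x i = g ∧ ∀ j ∈ s, x j = 1}
      one_mem' := ⟨1, K.one_mem, rfl, fun _ _ => rfl⟩
      mul_mem' := by
        rintro _ _ ⟨x, hx, rfl, hx'⟩ ⟨y, hy, rfl, hy'⟩
        exact ⟨x * y, K.mul_mem hx hy, rfl, fun j hj => by simp [hx' j hj, hy' j hj]⟩
      inv_mem' := by
        rintro _ ⟨x, hx, rfl, hx'⟩
        exact ⟨x⁻¹, K.inv_mem hx, rfl, fun j hj => by simp [hx' j hj]⟩ }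
  have hmem : ∀ i s g, g ∈ N i s ↔ ∃ x ∈ K, x i = g ∧ ∀ j ∈ s, x j = 1 := fun _ _ _ => Iff.rfl
  have hnorm : ∀ i s, (N i s).Normal := by
    intro i s
    refine ⟨?_⟩
    rintro _ ⟨x, hx, rfl, hx'⟩ g
    obtain ⟨y, hy, rfl⟩ := hsurj i g
    exact ⟨y * x * y⁻¹, K.mul_mem (K.mul_mem hy hx) (K.inv_mem hy), rfl,
      fun j hj => by simp [hx' j hj]⟩
  have htop1 : ∀ i j, i ≠ j → N i {j} = ⊤ := by
    intro i j hij
    obtain ⟨x, hx, h1, h2⟩ := hpair i j hij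
    exact normal_eq_top (hp i) _ (hnorm i _) (x i) ⟨x, hx, rfl, by simpa using h1⟩ h2
  have htop : ∀ i (s : Finset (Fin k)), i ∉ s → N i s = ⊤ := by
    intro i s
    induction s using Finset.induction_on with
    | empty =>
      intro _
      rw [eq_top_iff]
      intro g _
      obtain ⟨x, hx, h⟩ := hsurj i g
      exact ⟨x, hx, h, by simp⟩
    | insert j s hj ih =>
      intro his
      have hij : i ≠ j := fun h => his (by simp [h])
      have hs : i ∉ s := fun h => his (by simp [h])
      have hu : uu (1 : ZMod (p i)) ∈ N i s := by rw [ih hs]; trivial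
      have hl : ll (1 : ZMod (p i)) ∈ N i {j} := by rw [htop1 i j hij]; trivial
      obtain ⟨x, hx, hxi, hxs⟩ := hu
      obtain ⟨y, hy, hyi, hys⟩ := hl
      refine normal_eq_top (hp i) _ (hnorm i _) (uu 1 * ll 1 * (uu 1)⁻¹ * (ll 1)⁻¹)
        ⟨x * y * x⁻¹ * y⁻¹,
          K.mul_mem (K.mul_mem (K.mul_mem hx hy) (K.inv_mem hx)) (K.inv_mem hy), ?_, ?_⟩ ?_
      · simp [hxi, hyi]
      · intro m hm
        rw [Finset.mem_insert] at hm
        rcases hm with rfl | hm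
        · simp [hys m (by simp)]
        · simp [hxs m hm]
      · rw [uu_inv, ll_inv]
        simp [mulE, inv00, inv01, inv10, inv11,
      uu00, uu01, uu10, uu11, ll00, ll01, ll10, ll11]
  rw [eq_top_iff]
  intro x _
  refine Subgroup.pi_mem_of_mulSingle_mem x (fun i => ?_)
  have : x i ∈ N i (Finset.univ.erase i) := by
    rw [htop i _ (by simp)]; trivial
  obtain ⟨y, hy, hyi, hys⟩ := this
  convert hy using 1
  funext j
  by_cases h : j = i
  · subst h; simp [hyi]
  · rw [Pi.mulSingle_eq_of_ne h, hys j (by simp [h])]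

/-- From the two families of unipotents to everything. -/
lemma unip_eq_top {k : ℕ} (p : Fin k → ℕ) [∀ i, Fact (p i).Prime] (hp : ∀ i, 7 ≤ p i)
    (lam : Fin k → ℤ) (hlam : ∀ i, (lam i : ZMod (p i)) ≠ 0)
    (hne : ∀ i j : Fin k, p i = p j → i ≠ j →
        ((lam i : ZMod (p i)) ≠ ((lam j : ℤ) : ZMod (p i)) ∧
         (lam i : ZMod (p i)) ≠ -((lam j : ℤ) : ZMod (p i))))
    (K : Subgroup (∀ i, SL(2, ZMod (p i))))
    (hU : ∀ t : ℤ, (fun i => uu ((t : ZMod (p i)) * lam i)) ∈ K)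
    (hL : ∀ t : ℤ, (fun i => ll ((t : ZMod (p i)) * lam i)) ∈ K) : K = ⊤ := by
  refine prod_eq_top p hp K ?_ ?_
  · intro i g
    have : K.map (Pi.evalMonoidHom (fun i => SL(2, ZMod (p i))) i) = ⊤ := by
      refine eq_top_of_unip _ (fun t => ?_) (fun t => ?_)
      all_goals obtain ⟨n, hn⟩ := ZMod.intCast_surjective (t / (lam i : ZMod (p i)))
      · refine ⟨_, hU n, ?_⟩
        simp [hn, div_mul_cancel₀ _ (hlam i)]
      · refine ⟨_, hL n, ?_⟩
        simp [hn, div_mul_cancel₀ _ (hlam i)]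
    have hg : g ∈ K.map (Pi.evalMonoidHom (fun i => SL(2, ZMod (p i))) i) := by
      rw [this]; trivial
    obtain ⟨x, hx, h⟩ := hg
    exact ⟨x, hx, h⟩
  · intro i j hij
    by_cases hpp : p i = p j
    · obtain ⟨a, ha⟩ := ZMod.intCast_surjective (-((lam j : ZMod (p j)) ^ 2)⁻¹)
      have haj : (a : ZMod (p j)) * (lam j : ZMod (p j)) ^ 2 = -1 := by
        rw [ha, neg_mul, inv_mul_cancel₀ (pow_ne_zero 2 (hlam j))]
      have hai : (a : ZMod (p i)) * (lam j : ZMod (p i)) ^ 2 = -1 := by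
        have h1 : ((a * lam j ^ 2 + 1 : ℤ) : ZMod (p j)) = 0 := by
          push_cast; rw [haj]; ring
        rw [ZMod.intCast_zmod_eq_zero_iff_dvd, ← hpp, ← ZMod.intCast_zmod_eq_zero_iff_dvd] at h1
        push_cast at h1
        linear_combination h1
      obtain ⟨hn1, hn2⟩ := hne i j hpp hij
      have hα : 1 + (a : ZMod (p i)) * (lam i : ZMod (p i)) ^ 2 ≠ 0 := by
        intro h
        have : ((lam i : ZMod (p i)) - lam j) * ((lam i : ZMod (p i)) + lam j) = 0 := by
          linear_combination (lam i : ZMod (p i)) ^ 2 * hai - (lam j : ZMod (p i)) ^ 2 * h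
        rcases mul_eq_zero.1 this with h | h
        · exact hn1 (sub_eq_zero.1 h)
        · exact hn2 (eq_neg_of_add_eq_zero_left h)
      have hg := K.mul_mem (K.mul_mem (hU a) (hL 1)) (hU a)
      refine ⟨_, K.mul_mem (K.mul_mem (K.mul_mem hg (hU 1)) (K.inv_mem hg)) (hL (lam j ^ 2)),
        ?_, ?_⟩
      · simp only [Pi.mul_apply, Pi.inv_apply]
        push_cast
        generalize (lam j : ZMod (p j)) = l at *
        generalize (a : ZMod (p j)) = a at *
        apply ext4 <;> simp [mulE, inv00, inv01, inv10, inv11,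
      uu00, uu01, uu10, uu11, ll00, ll01, ll10, ll11]
        · linear_combination (-l ^ 2 + l ^ 4 * (1 + a * l ^ 2)) * haj
        · linear_combination (l * (1 + a * l ^ 2)) * haj
        · linear_combination (l ^ 5) * haj
        · linear_combination (l ^ 2) * haj
      · simp only [Pi.mul_apply, Pi.inv_apply]
        have h0 := hlam i
        have : (lam i : ZMod (p i)) * (1 + (a : ZMod (p i)) * (lam i : ZMod (p i)) ^ 2) ^ 2 ≠ 0 :=
          mul_ne_zero h0 (pow_ne_zero 2 hα)
        intro h
        apply this
        rw [← h]
        simp [mulE, inv00, inv01, inv10, inv11,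
      uu00, uu01, uu10, uu11, ll00, ll01, ll10, ll11]
        ring
    · refine ⟨_, hU (p j), ?_, ?_⟩
      · simp [uu_zero]
      · simp only [uu]
        have : ((p j : ℤ) : ZMod (p i)) ≠ 0 := by
          intro h
          rw [Int.cast_natCast, ZMod.natCast_eq_zero_iff] at h
          exact hpp ((Nat.prime_dvd_prime_iff_eq (Fact.out) (Fact.out)).1 h)
        simpa using ⟨by simpa using this, hlam i⟩


lemma Ttil_eq {p : ℕ} [Fact p.Prime] (lam w : ZMod p) (hw : w ≠ 0) :
    Ttil lam w = uu lam * ww * dd w⁻¹ (inv_ne_zero hw) := by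
  have h : (!![lam * w⁻¹, -w; w⁻¹, 0] : Matrix (Fin 2) (Fin 2) (ZMod p)).det = 1 := by
    simp [Matrix.det_fin_two, hw]
  have h' : Ttil lam w = ⟨!![lam * w⁻¹, -w; w⁻¹, 0], h⟩ := dif_pos h
  rw [h']
  apply ext4 <;> simp [mulE, inv00, inv01, inv10, inv11,
      uu00, uu01, uu10, uu11, ll00, ll01, ll10, ll11, dd00, dd01,
      dd10, dd11, ww00, ww01, ww10, ww11]

lemma z_eq (lam w w' : F) (hw : w ≠ 0) (hw' : w' ≠ 0) :
    (uu lam * ww * dd w'⁻¹ (inv_ne_zero hw'))⁻¹ * (uu lam * ww * dd w⁻¹ (inv_ne_zero hw)) =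
      dd (w' / w) (div_ne_zero hw' hw) := by
  apply ext4 <;> simp [mulE, inv00, inv01, inv10, inv11,
      uu00, uu01, uu10, uu11, ll00, ll01, ll10, ll11, dd00, dd01,
      dd10, dd11, ww00, ww01, ww10, ww11] <;> field_simp <;> try ring

lemma x_eq (lam w d : F) (hw : w ≠ 0) (hd : d ≠ 0) :
    (uu lam * ww * dd w⁻¹ (inv_ne_zero hw)) * dd d hd *
      (uu lam * ww * dd w⁻¹ (inv_ne_zero hw))⁻¹ = uu lam * dd d⁻¹ (inv_ne_zero hd) * uu (-lam) := by
  apply ext4 <;> simp [mulE, inv00, inv01, inv10, inv11,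
      uu00, uu01, uu10, uu11, ll00, ll01, ll10, ll11, dd00, dd01,
      dd10, dd11, ww00, ww01, ww10, ww11] <;> field_simp <;> try ring

lemma comm_eq (lam d : F) (hd : d ≠ 0) :
    dd d hd * (uu lam * dd d⁻¹ (inv_ne_zero hd) * uu (-lam)) * (dd d hd)⁻¹ *
      (uu lam * dd d⁻¹ (inv_ne_zero hd) * uu (-lam))⁻¹ = uu (lam * (d - d⁻¹) ^ 2) := by
  apply ext4 <;> simp [mulE, inv00, inv01, inv10, inv11,
      uu00, uu01, uu10, uu11, ll00, ll01, ll10, ll11, dd00, dd01,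
      dd10, dd11, ww00, ww01, ww10, ww11] <;> field_simp <;> try ring

lemma conj_eq (lam w s : F) (hw : w ≠ 0) :
    uu (-lam) * ((uu lam * ww * dd w⁻¹ (inv_ne_zero hw)) * uu s *
      (uu lam * ww * dd w⁻¹ (inv_ne_zero hw))⁻¹) * uu lam = ll (-s / w ^ 2) := by
  apply ext4 <;> simp [mulE, inv00, inv01, inv10, inv11,
      uu00, uu01, uu10, uu11, ll00, ll01, ll10, ll11, dd00, dd01,
      dd10, dd11, ww00, ww01, ww10, ww11] <;> field_simp <;> try ring

lemma main_sl {k : ℕ} (w w' : ℤ) (p : Fin k → ℕ) [∀ i, Fact (p i).Prime] (hp : ∀ i, 7 ≤ p i)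
    (hw : ∀ i, (w : ZMod (p i)) ≠ 0) (hw' : ∀ i, (w' : ZMod (p i)) ≠ 0)
    (hd : ∀ i, ((w' ^ 2 - w ^ 2 : ℤ) : ZMod (p i)) ≠ 0)
    (lam : Fin k → ℤ) (hlam : ∀ i, (lam i : ZMod (p i)) ≠ 0)
    (hne : ∀ i j : Fin k, p i = p j → i ≠ j →
        ((lam i : ZMod (p i)) ≠ ((lam j : ℤ) : ZMod (p i)) ∧
         (lam i : ZMod (p i)) ≠ -((lam j : ℤ) : ZMod (p i))))
    (K : Subgroup (∀ i, SL(2, ZMod (p i)))) (A B : ∀ i, SL(2, ZMod (p i)))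
    (hA : A = fun i => Ttil (lam i : ZMod (p i)) (w : ZMod (p i)))
    (hB : B = fun i => Ttil (lam i : ZMod (p i)) (w' : ZMod (p i)))
    (h0 : B⁻¹ * A ∈ K) (h1 : A * (B⁻¹ * A) * A⁻¹ ∈ K)
    (h2 : A * (A * (B⁻¹ * A) * A⁻¹) * A⁻¹ ∈ K) : K = ⊤ := by
  have hAi : ∀ i, A i = uu (lam i : ZMod (p i)) * ww * dd (w : ZMod (p i))⁻¹
      (inv_ne_zero (hw i)) := by
    intro i; rw [hA]; exact Ttil_eq _ _ (hw i)
  have hBi : ∀ i, B i = uu (lam i : ZMod (p i)) * ww * dd (w' : ZMod (p i))⁻¹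
      (inv_ne_zero (hw' i)) := by
    intro i; rw [hB]; exact Ttil_eq _ _ (hw' i)
  set z := B⁻¹ * A with hz
  set x := A * z * A⁻¹ with hx
  let d : ∀ i, ZMod (p i) := fun i => (w' : ZMod (p i)) / w
  have hdne : ∀ i, d i ≠ 0 := fun i => div_ne_zero (hw' i) (hw i)
  have hzi : ∀ i, z i = dd (d i) (hdne i) := by
    intro i
    rw [hz, Pi.mul_apply, Pi.inv_apply, hAi, hBi, z_eq _ _ _ (hw i) (hw' i)]
  have hxi : ∀ i, x i = uu (lam i : ZMod (p i)) * dd (d i)⁻¹ (inv_ne_zero (hdne i)) *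
      uu (-(lam i : ZMod (p i))) := by
    intro i
    rw [hx, Pi.mul_apply, Pi.mul_apply, Pi.inv_apply, hAi, hzi, x_eq _ _ _ (hw i)]
  let e : ∀ i, ZMod (p i) := fun i => (d i - (d i)⁻¹) ^ 2
  have hc : z * x * z⁻¹ * x⁻¹ = fun i => uu ((lam i : ZMod (p i)) * e i) := by
    funext i
    simp only [Pi.mul_apply, Pi.inv_apply]
    rw [hzi, hxi, comm_eq]
  have hcK : (fun i => uu ((lam i : ZMod (p i)) * e i)) ∈ K := by
    rw [← hc]
    exact K.mul_mem (K.mul_mem (K.mul_mem h0 h1) (K.inv_mem h0)) (K.inv_mem h1)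
  have hcK' : A * (fun i => uu ((lam i : ZMod (p i)) * e i)) * A⁻¹ ∈ K := by
    rw [← hc]
    have : A * (z * x * z⁻¹ * x⁻¹) * A⁻¹ = x * (A * x * A⁻¹) * x⁻¹ * (A * x * A⁻¹)⁻¹ := by
      rw [hx]; group
    rw [this]
    exact K.mul_mem (K.mul_mem (K.mul_mem h1 h2) (K.inv_mem h1)) (K.inv_mem h2)
  obtain ⟨n, hn⟩ : ∃ n : ℤ, ∀ i, (n : ZMod (p i)) * e i = 1 := by
    have hcop : IsCoprime ((w' ^ 2 - w ^ 2) ^ 2 : ℤ) (∏ i, (p i : ℤ)) := by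
      refine IsCoprime.prod_right (fun i _ => IsCoprime.pow_left ?_)
      refine IsCoprime.symm ((Nat.prime_iff_prime_int.1 Fact.out).coprime_iff_not_dvd.2 ?_)
      intro h
      exact hd i ((ZMod.intCast_zmod_eq_zero_iff_dvd _ _).2 h)
    obtain ⟨a, b, hab⟩ := hcop
    refine ⟨(w * w') ^ 2 * a, fun i => ?_⟩
    have h1 : (a : ZMod (p i)) * ((w' : ZMod (p i)) ^ 2 - (w : ZMod (p i)) ^ 2) ^ 2 = 1 := by
      have := congrArg (fun m : ℤ => (m : ZMod (p i))) hab
      have hprod : ((∏ i, (p i : ℤ) : ℤ) : ZMod (p i)) = 0 := by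
        rw [ZMod.intCast_zmod_eq_zero_iff_dvd]
        exact Finset.dvd_prod_of_mem (fun i => (p i : ℤ)) (Finset.mem_univ i)
      simp only [Int.cast_add, Int.cast_mul, hprod, mul_zero, add_zero] at this
      push_cast at this
      exact this
    have h3 := hw i
    have h4 := hw' i
    simp only [e, d]
    push_cast
    rw [← h1]
    field_simp
  have hU : ∀ t : ℤ, (fun i => uu ((t : ZMod (p i)) * lam i)) ∈ K := by
    intro t
    convert K.zpow_mem hcK (n * t) using 1
    funext i
    rw [Pi.pow_apply, uu_zpow]
    congr 1
    push_cast
    linear_combination (-(t : ZMod (p i)) * lam i) * hn i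
  have hL1 : (fun i => ll (-((lam i : ZMod (p i)) * e i) / (w : ZMod (p i)) ^ 2)) ∈ K := by
    convert K.mul_mem (K.mul_mem (hU (-1)) hcK') (hU 1) using 1
    funext i
    simp only [Pi.mul_apply, Pi.inv_apply]
    rw [hAi, ← conj_eq (lam i : ZMod (p i)) _ _ (hw i)]
    simp
  have hL : ∀ t : ℤ, (fun i => ll ((t : ZMod (p i)) * lam i)) ∈ K := by
    intro t
    convert K.zpow_mem hL1 (-(n * t * w ^ 2)) using 1
    funext i
    rw [Pi.pow_apply, ll_zpow]
    congr 1
    have h3 := hw i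
    push_cast
    field_simp
    linear_combination (-(t : ZMod (p i)) * lam i) * hn i
  exact unip_eq_top p hp lam hlam hne K hU hL

/-- Transfer to the product of the projective groups. -/
lemma main_psl {k : ℕ} (w w' : ℤ) (p : Fin k → ℕ) [∀ i, Fact (p i).Prime] (hp : ∀ i, 7 ≤ p i)
    (hw : ∀ i, (w : ZMod (p i)) ≠ 0) (hw' : ∀ i, (w' : ZMod (p i)) ≠ 0)
    (hd : ∀ i, ((w' ^ 2 - w ^ 2 : ℤ) : ZMod (p i)) ≠ 0)
    (lam : Fin k → ℤ) (hlam : ∀ i, (lam i : ZMod (p i)) ≠ 0)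
    (hne : ∀ i j : Fin k, p i = p j → i ≠ j →
        ((lam i : ZMod (p i)) ≠ ((lam j : ℤ) : ZMod (p i)) ∧
         (lam i : ZMod (p i)) ≠ -((lam j : ℤ) : ZMod (p i))))
    (H : Subgroup (∀ i, PSL(2, ZMod (p i)))) (A B c : ∀ i, PSL(2, ZMod (p i)))
    (hA : A = fun i => Ttilbar (lam i : ZMod (p i)) (w : ZMod (p i)))
    (hB : B = fun i => Ttilbar (lam i : ZMod (p i)) (w' : ZMod (p i)))
    (h0 : c * (B⁻¹ * A) * c⁻¹ ∈ H) (h1 : c * (A * (B⁻¹ * A) * A⁻¹) * c⁻¹ ∈ H)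
    (h2 : c * (A * (A * (B⁻¹ * A) * A⁻¹) * A⁻¹) * c⁻¹ ∈ H) : H = ⊤ := by
  let π : (∀ i, SL(2, ZMod (p i))) →* (∀ i, PSL(2, ZMod (p i))) :=
    MonoidHom.pi fun i => (QuotientGroup.mk' _).comp (Pi.evalMonoidHom _ i)
  have hπ : Function.Surjective π := by
    intro y
    choose x hx using fun i => QuotientGroup.mk'_surjective _ (y i)
    exact ⟨x, funext hx⟩
  have hAπ : π (fun i => Ttil (lam i : ZMod (p i)) (w : ZMod (p i))) = A := by rw [hA]; rfl
  have hBπ : π (fun i => Ttil (lam i : ZMod (p i)) (w' : ZMod (p i))) = B := by rw [hB]; rfl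
  have key : H.comap ((MulAut.conj c).toMonoidHom.comp π) = ⊤ := by
    refine main_sl w w' p hp hw hw' hd lam hlam hne _ _ _ rfl rfl ?_ ?_ ?_ <;>
      rw [Subgroup.mem_comap, MonoidHom.comp_apply, MulEquiv.coe_toMonoidHom,
        MulAut.conj_apply] <;> simp only [map_mul, map_inv, hAπ, hBπ] <;> assumption
  rw [eq_top_iff]
  intro y _
  obtain ⟨x, hx⟩ := hπ (c⁻¹ * y * c)
  have : x ∈ H.comap ((MulAut.conj c).toMonoidHom.comp π) := by rw [key]; trivial
  rw [Subgroup.mem_comap, MonoidHom.comp_apply, hx] at this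
  simpa [mul_assoc] using this

end DysonAux


/-- Let `w, w'` be nonzero integers with `w ≠ ±w'`.  There exists a constant
`C(w, w')` such that for every `k ≥ 1`, all primes `p 0, …, p (k-1) ≥ C(w, w')`, and all nonzero
`λ i ∈ 𝔽_{p i}` (given by integer representatives) with `λ i ≠ ±λ j` whenever `p i = p j` and
`i ≠ j`, letting `S = {(T̃(λ 0, w), …, T̃(λ (k-1), w)), (T̃(λ 0, w'), …, T̃(λ (k-1), w'))}`
inside `PSL₂(p 0) × ⋯ × PSL₂(p (k-1))`, the subgroup generated by `S³S⁻³` equals the full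
product, and likewise for the subgroup generated by `S⁻³S³`. -/
theorem psl2_product_generation_dyson (w w' : ℤ) (hw : w ≠ 0) (hw' : w' ≠ 0) (hww' : w ≠ w')
    (hww'' : w ≠ -w') :
    ∃ C : ℕ, ∀ (k : ℕ), 1 ≤ k → ∀ (p : Fin k → ℕ), (∀ i, (p i).Prime) → (∀ i, C ≤ p i) →
      ∀ lam : Fin k → ℤ, (∀ i, ((lam i : ZMod (p i))) ≠ 0) →
      (∀ i j : Fin k, p i = p j → i ≠ j →
        ((lam i : ZMod (p i)) ≠ ((lam j : ℤ) : ZMod (p i)) ∧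
         (lam i : ZMod (p i)) ≠ -((lam j : ℤ) : ZMod (p i)))) →
      (Subgroup.closure {x : ∀ i : Fin k, PSL(2, ZMod (p i)) |
          ∃ g₁ ∈ ({fun i => Ttilbar (lam i : ZMod (p i)) (w : ZMod (p i)),
                    fun i => Ttilbar (lam i : ZMod (p i)) (w' : ZMod (p i))} :
                    Set (∀ i : Fin k, PSL(2, ZMod (p i)))),
          ∃ g₂ ∈ ({fun i => Ttilbar (lam i : ZMod (p i)) (w : ZMod (p i)),
                    fun i => Ttilbar (lam i : ZMod (p i)) (w' : ZMod (p i))} :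
                    Set (∀ i : Fin k, PSL(2, ZMod (p i)))),
          ∃ g₃ ∈ ({fun i => Ttilbar (lam i : ZMod (p i)) (w : ZMod (p i)),
                    fun i => Ttilbar (lam i : ZMod (p i)) (w' : ZMod (p i))} :
                    Set (∀ i : Fin k, PSL(2, ZMod (p i)))),
          ∃ g₄ ∈ ({fun i => Ttilbar (lam i : ZMod (p i)) (w : ZMod (p i)),
                    fun i => Ttilbar (lam i : ZMod (p i)) (w' : ZMod (p i))} :
                    Set (∀ i : Fin k, PSL(2, ZMod (p i)))),
          ∃ g₅ ∈ ({fun i => Ttilbar (lam i : ZMod (p i)) (w : ZMod (p i)),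
                    fun i => Ttilbar (lam i : ZMod (p i)) (w' : ZMod (p i))} :
                    Set (∀ i : Fin k, PSL(2, ZMod (p i)))),
          ∃ g₆ ∈ ({fun i => Ttilbar (lam i : ZMod (p i)) (w : ZMod (p i)),
                    fun i => Ttilbar (lam i : ZMod (p i)) (w' : ZMod (p i))} :
                    Set (∀ i : Fin k, PSL(2, ZMod (p i)))),
            x = g₁ * g₂ * g₃ * g₄⁻¹ * g₅⁻¹ * g₆⁻¹} = ⊤) ∧
      (Subgroup.closure {x : ∀ i : Fin k, PSL(2, ZMod (p i)) |
          ∃ g₁ ∈ ({fun i => Ttilbar (lam i : ZMod (p i)) (w : ZMod (p i)),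
                    fun i => Ttilbar (lam i : ZMod (p i)) (w' : ZMod (p i))} :
                    Set (∀ i : Fin k, PSL(2, ZMod (p i)))),
          ∃ g₂ ∈ ({fun i => Ttilbar (lam i : ZMod (p i)) (w : ZMod (p i)),
                    fun i => Ttilbar (lam i : ZMod (p i)) (w' : ZMod (p i))} :
                    Set (∀ i : Fin k, PSL(2, ZMod (p i)))),
          ∃ g₃ ∈ ({fun i => Ttilbar (lam i : ZMod (p i)) (w : ZMod (p i)),
                    fun i => Ttilbar (lam i : ZMod (p i)) (w' : ZMod (p i))} :
                    Set (∀ i : Fin k, PSL(2, ZMod (p i)))),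
          ∃ g₄ ∈ ({fun i => Ttilbar (lam i : ZMod (p i)) (w : ZMod (p i)),
                    fun i => Ttilbar (lam i : ZMod (p i)) (w' : ZMod (p i))} :
                    Set (∀ i : Fin k, PSL(2, ZMod (p i)))),
          ∃ g₅ ∈ ({fun i => Ttilbar (lam i : ZMod (p i)) (w : ZMod (p i)),
                    fun i => Ttilbar (lam i : ZMod (p i)) (w' : ZMod (p i))} :
                    Set (∀ i : Fin k, PSL(2, ZMod (p i)))),
          ∃ g₆ ∈ ({fun i => Ttilbar (lam i : ZMod (p i)) (w : ZMod (p i)),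
                    fun i => Ttilbar (lam i : ZMod (p i)) (w' : ZMod (p i))} :
                    Set (∀ i : Fin k, PSL(2, ZMod (p i)))),
            x = g₁⁻¹ * g₂⁻¹ * g₃⁻¹ * g₄ * g₅ * g₆} = ⊤) := by
  refine ⟨7 + (w * w' * (w' ^ 2 - w ^ 2)).natAbs, ?_⟩
  intro k _ p hprime hC lam hlam hne
  have : ∀ i, Fact (p i).Prime := fun i => ⟨hprime i⟩
  have hnz : w * w' * (w' ^ 2 - w ^ 2) ≠ 0 := by
    refine mul_ne_zero (mul_ne_zero hw hw') ?_
    intro h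
    rcases sq_eq_sq_iff_eq_or_eq_neg.1 (sub_eq_zero.1 h) with h | h
    · exact hww' h.symm
    · exact hww'' (by rw [h, neg_neg])
  have hall : ∀ i, ((w * w' * (w' ^ 2 - w ^ 2) : ℤ) : ZMod (p i)) ≠ 0 := by
    intro i h
    rw [ZMod.intCast_zmod_eq_zero_iff_dvd, Int.natCast_dvd] at h
    have := Nat.le_of_dvd (Int.natAbs_pos.2 hnz) h
    have := hC i
    omega
  have hp : ∀ i, 7 ≤ p i := fun i => le_trans (Nat.le_add_right _ _) (hC i)
  have hw1 : ∀ i, (w : ZMod (p i)) ≠ 0 := fun i h => hall i (by push_cast; rw [h]; ring)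
  have hw2 : ∀ i, (w' : ZMod (p i)) ≠ 0 := fun i h => hall i (by push_cast; rw [h]; ring)
  have hw3 : ∀ i, ((w' ^ 2 - w ^ 2 : ℤ) : ZMod (p i)) ≠ 0 := fun i h =>
    hall i (by rw [Int.cast_mul, h, mul_zero])
  generalize hA : (fun i => Ttilbar (lam i : ZMod (p i)) (w : ZMod (p i))) = A
  generalize hB : (fun i => Ttilbar (lam i : ZMod (p i)) (w' : ZMod (p i))) = B
  have mA : A ∈ ({A, B} : Set (∀ i : Fin k, PSL(2, ZMod (p i)))) := by simp
  have mB : B ∈ ({A, B} : Set (∀ i : Fin k, PSL(2, ZMod (p i)))) := by simp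
  constructor
  · refine DysonAux.main_psl w w' p hp hw1 hw2 hw3 lam hlam hne _ A B A hA.symm hB.symm ?_ ?_ ?_ <;>
      apply Subgroup.subset_closure
    · exact ⟨A, mA, A, mA, A, mA, A, mA, A, mA, B, mB, by group⟩
    · exact ⟨A, mA, A, mA, A, mA, A, mA, B, mB, A, mA, by group⟩
    · exact ⟨A, mA, A, mA, A, mA, B, mB, A, mA, A, mA, by group⟩
  · refine DysonAux.main_psl w w' p hp hw1 hw2 hw3 lam hlam hne _ A B (A⁻¹ * A⁻¹)
      hA.symm hB.symm ?_ ?_ ?_ <;> apply Subgroup.subset_closure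
    · exact ⟨A, mA, A, mA, B, mB, A, mA, A, mA, A, mA, by simp [mul_assoc]⟩
    · exact ⟨A, mA, B, mB, A, mA, A, mA, A, mA, A, mA, by simp [mul_assoc]⟩
    · exact ⟨B, mB, A, mA, A, mA, A, mA, A, mA, A, mA, by simp [mul_assoc]⟩

end
end
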